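/- For every nonempty finite set D of positive integers with t = Max(D), one has A_D ≤ 3^(t−1). -/

import Mathlib

open Filter Topology Set

/-- A numerical set: a cofinite subset of ℕ containing 0, not all of ℕ. -/
def IsNumericalSet (T : Set ℕ) : Prop :=
  0 ∈ T ∧ Tᶜ.Finite ∧ Tᶜ.Nonempty

/-- A numerical semigroup: a numerical set closed under addition. -/
def IsNumericalSemigroup (S : Set ℕ) : Prop :=
  IsNumericalSet S ∧ ∀ a ∈ S, ∀ b ∈ S, a + b ∈ S

/-- Frobenius number: the largest element of the complement. -/
noncomputable def frob (T : Set ℕ) : ℕ := sSup Tᶜ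

/-- The associated semigroup `A(T) = {t | t + T ⊆ T}`. -/
def AT (T : Set ℕ) : Set ℕ := {t : ℕ | ∀ x ∈ T, t + x ∈ T}

/-- Multiplicity: the smallest positive element. -/
noncomputable def mult (S : Set ℕ) : ℕ := sInf {x | x ∈ S ∧ 0 < x}

/-- `R(S) = f(S) - m(S)` as an integer. -/
noncomputable def RVal (S : Set ℕ) : ℤ := (frob S : ℤ) - (mult S : ℤ)

/-- `P(S)`: the number of numerical sets whose associated semigroup is `S`. -/
noncomputable def PCount (S : Set ℕ) : ℕ :=
  {T : Set ℕ | IsNumericalSet T ∧ AT T = S}.ncard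

/-- The density `μ(S) = P(S) / 2^(f(S)-1)`. -/
noncomputable def density (S : Set ℕ) : ℝ :=
  (PCount S : ℝ) / 2 ^ (frob S - 1)

/-- The numerical semigroup `N(D,f) = {0} ∪ {f - l : l ∈ D} ∪ (f, ∞)`. -/
def NSet (D : Finset ℕ) (f : ℕ) : Set ℕ :=
  {0} ∪ (fun l => f - l) '' (D : Set ℕ) ∪ {x | f < x}

/-- `B(D,f)`: numerical sets `T` with `f(T) = f` and
`A(T) ∩ [f - Max D, f - 1] = {f - l : l ∈ D}`. -/
def BSet (D : Finset ℕ) (f : ℕ) : Set (Set ℕ) :=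
  {T | IsNumericalSet T ∧ frob T = f ∧
    AT T ∩ Set.Icc (f - D.sup id) (f - 1) = (fun l => f - l) '' (D : Set ℕ)}

/-- `A_D = |B(D, 2 Max D + 1)|`. -/
noncomputable def AConst (D : Finset ℕ) : ℕ :=
  (BSet D (2 * D.sup id + 1)).ncard

/-- `B_l(k,f) = {T ∈ B({k},f) : T ∩ [1,l] = ∅}`. -/
def BlSet (l k f : ℕ) : Set (Set ℕ) :=
  {T | T ∈ BSet {k} f ∧ T ∩ Set.Icc 1 l = ∅}

/-- `C_{l,k}`. -/
noncomputable def CConst (l k : ℕ) : ℕ :=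
  if l ≤ k then (BlSet l k (2 * k + 1)).ncard else (BlSet l k (l + k + 1)).ncard

/-- `G_l(f) = {T : A(T) = N_f, T ∩ [1,l] = ∅}`. -/
def GSet (l f : ℕ) : Set (Set ℕ) :=
  {T | IsNumericalSet T ∧ AT T = NSet ∅ f ∧ T ∩ Set.Icc 1 l = ∅}

theorem IsNumericalSet.frob_notMem {T : Set ℕ} (hT : IsNumericalSet T) : frob T ∉ T :=
  Nat.sSup_mem hT.2.2 hT.2.1.bddAbove

theorem IsNumericalSet.mem_of_frob_lt {T : Set ℕ} (hT : IsNumericalSet T) {n : ℕ}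
    (hn : frob T < n) : n ∈ T := by
  by_contra h
  exact absurd (le_csSup hT.2.1.bddAbove h) (not_le.mpr hn)

theorem sub_sup_mem_AT {D : Finset ℕ} (hne : D.Nonempty) {f : ℕ} {T : Set ℕ}
    (hT : T ∈ BSet D f) : f - D.sup id ∈ AT T := by
  obtain ⟨d, hd, hdt⟩ := Finset.exists_mem_eq_sup D hne id
  have h : f - D.sup id ∈ (fun l => f - l) '' (D : Set ℕ) := ⟨d, hd, by simp [hdt]⟩
  rw [← hT.2.2] at h
  exact h.1

/-- A set in `B(D, 2t+1)` with `t = Max D` is determined by its membership pattern on the pairs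
`(x, t + 1 + x)` with `1 ≤ x ≤ t - 1`; membership of `x` forces that of `t + 1 + x`, so each
pair has at most three patterns. -/
noncomputable def pairPattern (t : ℕ) (T : Set ℕ) (i : Fin (t - 1)) : Fin 3 :=
  open Classical in
  if (i : ℕ) + 1 ∈ T then 2 else if t + 1 + (i + 1) ∈ T then 1 else 0

theorem mem_iff_of_pairPattern_eq {t : ℕ} {T U : Set ℕ} (hT : t + 1 ∈ AT T) (hU : t + 1 ∈ AT U)
    (h : pairPattern t T = pairPattern t U) {x : ℕ} (hx : 0 < x) (hxt : x < t) :
    (x ∈ T ↔ x ∈ U) ∧ (t + 1 + x ∈ T ↔ t + 1 + x ∈ U) := by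
  obtain ⟨y, rfl⟩ := Nat.exists_eq_add_of_lt hx
  rw [Nat.zero_add] at *
  have hi := congrFun h ⟨y, by omega⟩
  have hT' := hT (y + 1)
  have hU' := hU (y + 1)
  simp only [pairPattern] at hi
  by_cases h1 : y + 1 ∈ T <;> by_cases h2 : y + 1 ∈ U <;> by_cases h3 : t + 1 + (y + 1) ∈ T <;>
    by_cases h4 : t + 1 + (y + 1) ∈ U <;> simp_all

theorem injOn_pairPattern {D : Finset ℕ} (hne : D.Nonempty) :
    InjOn (pairPattern (D.sup id)) (BSet D (2 * D.sup id + 1)) := by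
  intro T hT U hU h
  have hTA := sub_sup_mem_AT hne hT
  have hUA := sub_sup_mem_AT hne hU
  obtain ⟨hTn, hTf, -⟩ := hT
  obtain ⟨hUn, hUf, -⟩ := hU
  generalize D.sup id = t at *
  rw [show 2 * t + 1 - t = t + 1 by omega] at hTA hUA
  have key : ∀ {V : Set ℕ}, IsNumericalSet V → frob V = 2 * t + 1 → t + 1 ∈ AT V →
      t ∉ V ∧ t + 1 ∈ V ∧ 2 * t + 1 ∉ V ∧ ∀ n, 2 * t + 1 < n → n ∈ V := by
    intro V hV hf hA
    have hfV : 2 * t + 1 ∉ V := hf ▸ hV.frob_notMem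
    refine ⟨fun ht => hfV ?_, hA 0 hV.1, hfV, fun n hn => hV.mem_of_frob_lt (hf ▸ hn)⟩
    rw [show 2 * t + 1 = t + 1 + t by ring]
    exact hA t ht
  obtain ⟨hT1, hT2, hT3, hT4⟩ := key hTn hTf hTA
  obtain ⟨hU1, hU2, hU3, hU4⟩ := key hUn hUf hUA
  ext n
  rcases Nat.eq_zero_or_pos n with rfl | hn
  · exact iff_of_true hTn.1 hUn.1
  rcases lt_trichotomy n t with hlt | rfl | hgt
  · exact (mem_iff_of_pairPattern_eq hTA hUA h hn hlt).1
  · exact iff_of_false hT1 hU1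
  obtain ⟨x, rfl⟩ := Nat.exists_eq_add_of_le (Nat.succ_le_of_lt hgt)
  rcases Nat.eq_zero_or_pos x with rfl | hx
  · exact iff_of_true hT2 hU2
  rcases lt_trichotomy x t with hlt | rfl | hgt'
  · exact (mem_iff_of_pairPattern_eq hTA hUA h hx hlt).2
  · rw [show x.succ + x = 2 * x + 1 by omega]
    exact iff_of_false hT3 hU3
  · exact iff_of_true (hT4 _ (by omega)) (hU4 _ (by omega))

theorem stmt13 (D : Finset ℕ) (hD : ∀ d ∈ D, 0 < d) (hne : D.Nonempty) :
    AConst D ≤ 3 ^ (D.sup id - 1) := by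
  calc AConst D ≤ (univ : Set (Fin (D.sup id - 1) → Fin 3)).ncard :=
        ncard_le_ncard_of_injOn _ (fun _ _ => mem_univ _) (injOn_pairPattern hne) finite_univ
    _ = 3 ^ (D.sup id - 1) := by simp [ncard_univ]
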